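/- arXiv:2409.00443 — 2 statements merged into one kernel-verified Lean document; each statement's English description precedes it below -/
import Mathlib

section
/- Let D: A→B be a strong deformation map in the quasi-twilled associative algebra A⊕B. For each n ≥ 0 define δ^D: Hom(A^⊗n, B) → Hom(A^⊗(n+1), B) by δ^D(f)(a_1,…,a_{n+1}) = a_1 ▷_D f(a_2,…,a_{n+1}) + Σ_{i=1}^{n} (−1)^i f(a_1,…,a_{i−1}, a_i ·_D a_{i+1}, …, a_{n+1}) + (−1)^{n+1} f(a_1,…,a_n) ◁_D a_{n+1}, where a·_D b := a·_A b + a↼D(b) + D(a)⇀b, a▷_D x := a▷x + D(a)·_B x − D(a↼x), and x◁_D a := x◁a + x·_B D(a) − D(x⇀a). Then δ^D ∘ δ^D = 0. -/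
variable {k A B : Type*} [Field k] [AddCommGroup A] [Module k A] [AddCommGroup B] [Module k B]

/-- The multiplication of the quasi-twilled associative algebra `A ⊕ B`:
`(a,x)·(b,y) = (a·_A b + a↼y + x⇀b, x·_B y + a▷y + x◁b + θ(a,b))`. -/
def qtMul (μ : A →ₗ[k] A →ₗ[k] A) (ν : B →ₗ[k] B →ₗ[k] B)
    (tr : A →ₗ[k] B →ₗ[k] B) (tl : B →ₗ[k] A →ₗ[k] B)
    (hr : B →ₗ[k] A →ₗ[k] A) (hl : A →ₗ[k] B →ₗ[k] A)
    (θ : A →ₗ[k] A →ₗ[k] B) (p q : A × B) : A × B :=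
  (μ p.1 q.1 + hl p.1 q.2 + hr p.2 q.1,
   ν p.2 q.2 + tr p.1 q.2 + tl p.2 q.1 + θ p.1 q.1)

/-- `a ·_D b := a·_A b + a↼D(b) + D(a)⇀b`. -/
def muD (μ : A →ₗ[k] A →ₗ[k] A) (hr : B →ₗ[k] A →ₗ[k] A) (hl : A →ₗ[k] B →ₗ[k] A)
    (D : A →ₗ[k] B) (a b : A) : A :=
  μ a b + hl a (D b) + hr (D a) b

/-- `a ▷_D x := a▷x + D(a)·_B x − D(a↼x)`. -/
def trD (ν : B →ₗ[k] B →ₗ[k] B) (tr : A →ₗ[k] B →ₗ[k] B) (hl : A →ₗ[k] B →ₗ[k] A)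
    (D : A →ₗ[k] B) (a : A) (x : B) : B :=
  tr a x + ν (D a) x - D (hl a x)

/-- `x ◁_D a := x◁a + x·_B D(a) − D(x⇀a)`. -/
def tlD (ν : B →ₗ[k] B →ₗ[k] B) (tl : B →ₗ[k] A →ₗ[k] B) (hr : B →ₗ[k] A →ₗ[k] A)
    (D : A →ₗ[k] B) (x : B) (a : A) : B :=
  tl x a + ν x (D a) - D (hr x a)

/-- The Hochschild-type coboundary operator associated to a multiplication `mu` on `R`,
a left action `actL` and a right action `actR` of `R` on `M`:
`(δ f)(a₁,…,a_{n+1}) = a₁ ▷ f(a₂,…,a_{n+1}) + Σᵢ (−1)ⁱ f(a₁,…,aᵢ·a_{i+1},…,a_{n+1})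
  + (−1)^{n+1} f(a₁,…,aₙ) ◁ a_{n+1}`. -/
def hochD {R M : Type*} [AddCommGroup M] (mu : R → R → R)
    (actL : R → M → M) (actR : M → R → M)
    (n : ℕ) (f : (Fin n → R) → M) : (Fin (n + 1) → R) → M :=
  fun a =>
    actL (a 0) (f fun i => a i.succ)
      + ∑ i : Fin n, ((-1 : ℤ) ^ ((i : ℕ) + 1)) •
          f (fun j => if (j : ℕ) < (i : ℕ) then a j.castSucc
                      else if (j : ℕ) = (i : ℕ) then mu (a j.castSucc) (a j.succ)
                      else a j.succ)
      + ((-1 : ℤ) ^ (n + 1)) • actR (f fun i => a i.castSucc) (a (Fin.last n))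

/-- Multiply the adjacent entries `a i` and `a (i + 1)` of a tuple. -/
def mergeAt {R : Type*} (mu : R → R → R) {n : ℕ} (i : ℕ) (a : Fin (n + 1) → R) : Fin n → R :=
  fun j => if (j : ℕ) < i then a j.castSucc
    else if (j : ℕ) = i then mu (a j.castSucc) (a j.succ)
    else a j.succ

theorem mergeAt_mergeAt {R : Type*} {mu : R → R → R}
    (hmu : ∀ a b c, mu (mu a b) c = mu a (mu b c)) {n p q : ℕ} (hpq : p ≤ q)
    (a : Fin (n + 2) → R) :
    mergeAt mu p (mergeAt mu (q + 1) a) = mergeAt mu q (mergeAt mu p a) := by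
  funext j
  simp only [mergeAt, Fin.val_castSucc, Fin.val_succ, Fin.castSucc_succ]
  split_ifs <;> first | rfl | omega | exact (hmu _ _ _).symm

theorem tail_mergeAt_succ {R : Type*} (mu : R → R → R) {n : ℕ} (q : ℕ) (a : Fin (n + 2) → R) :
    Fin.tail (mergeAt mu (q + 1) a) = mergeAt mu q (Fin.tail a) := by
  funext j
  simp only [mergeAt, Fin.tail, Fin.val_succ, Fin.castSucc_succ, add_lt_add_iff_right,
    add_left_inj]

theorem tail_mergeAt_zero {R : Type*} (mu : R → R → R) {n : ℕ} (a : Fin (n + 2) → R) :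
    Fin.tail (mergeAt mu 0 a) = Fin.tail (Fin.tail a) := by
  funext j
  simp [mergeAt, Fin.tail]

theorem init_mergeAt {R : Type*} (mu : R → R → R) {n : ℕ} (q : ℕ) (a : Fin (n + 2) → R) :
    Fin.init (mergeAt mu q a) = mergeAt mu q (Fin.init a) := by
  funext j
  simp only [mergeAt, Fin.init, Fin.val_castSucc, Fin.castSucc_succ]

theorem mergeAt_of_le {R : Type*} (mu : R → R → R) {n q : ℕ} (hq : n ≤ q) (a : Fin (n + 1) → R) :
    mergeAt mu q a = Fin.init a := by
  funext j
  have : (j : ℕ) < q := by omega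
  simp [mergeAt, Fin.init, this]

/-- The cofaces of the Hochschild complex: the action on the left for `i = 0`, the product of
adjacent entries for `1 ≤ i ≤ n`, and the action on the right for `i > n`. -/
def hochCoface {R M : Type*} [AddCommGroup M] (mu : R → R → R) (actL : R → M →+ M)
    (actR : R → M →+ M) (n i : ℕ) (f : (Fin n → R) → M) (a : Fin (n + 1) → R) : M :=
  if i = 0 then actL (a 0) (f (Fin.tail a))
  else if i ≤ n then f (mergeAt mu (i - 1) a)
  else actR (a (Fin.last n)) (f (Fin.init a))

theorem hochCoface_sum {R M ι : Type*} [AddCommGroup M] (mu : R → R → R) (actL : R → M →+ M)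
    (actR : R → M →+ M) (n i : ℕ) (s : Finset ι) (c : ι → ℤ) (f : ι → (Fin n → R) → M)
    (a : Fin (n + 1) → R) :
    hochCoface mu actL actR n i (fun v => ∑ t ∈ s, c t • f t v) a =
      ∑ t ∈ s, c t • hochCoface mu actL actR n i (f t) a := by
  unfold hochCoface
  split_ifs <;> simp only [map_sum, map_zsmul]

theorem hochD_eq_sum_hochCoface {R M : Type*} [AddCommGroup M] (mu : R → R → R)
    (actL : R → M →+ M) (actR : R → M →+ M) (n : ℕ) (f : (Fin n → R) → M)
    (a : Fin (n + 1) → R) :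
    hochD mu (fun r m => actL r m) (fun m r => actR r m) n f a =
      ∑ i ∈ Finset.range (n + 2), (-1 : ℤ) ^ i • hochCoface mu actL actR n i f a := by
  rw [Finset.sum_range_succ, Finset.sum_range_succ', add_comm (Finset.sum _ _),
    ← Fin.sum_univ_eq_sum_range
      (fun i => (-1 : ℤ) ^ (i + 1) • hochCoface mu actL actR n (i + 1) f a)]
  unfold hochD
  congr 1
  · congr 1
    · simp [hochCoface, Fin.tail_def]
    · refine Finset.sum_congr rfl fun i _ => ?_
      have : (i : ℕ) + 1 ≤ n := i.2
      simp only [hochCoface, Nat.add_eq_zero_iff, one_ne_zero, and_false, if_false, if_pos this,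
        Nat.add_sub_cancel]
      rfl
  · simp [hochCoface, Fin.init_def]

theorem hochCoface_hochCoface {R M : Type*} [AddCommGroup M] {mu : R → R → R}
    {actL actR : R → M →+ M} (hmu : ∀ a b c, mu (mu a b) c = mu a (mu b c))
    (hL : ∀ a b m, actL (mu a b) m = actL a (actL b m))
    (hR : ∀ a b m, actR (mu a b) m = actR b (actR a m))
    (hLR : ∀ a b m, actR b (actL a m) = actL a (actR b m))
    {n i j : ℕ} (hij : i ≤ j) (hj : j ≤ n + 1) (f : (Fin n → R) → M) (a : Fin (n + 2) → R) :
    hochCoface mu actL actR (n + 1) (j + 1) (hochCoface mu actL actR n i f) a =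
      hochCoface mu actL actR (n + 1) i (hochCoface mu actL actR n j f) a := by
  rcases i with _ | i <;> rcases j with _ | j
  · simp [hochCoface, tail_mergeAt_zero, mergeAt, hL, Fin.tail]
  · rcases hj.lt_or_eq with h | h
    · have h' : j + 1 ≤ n := by omega
      simp [hochCoface, tail_mergeAt_succ, h', mergeAt]
    · obtain rfl : j = n := by omega
      simp [hochCoface, hLR, Fin.init_def, Fin.tail_def]
  · omega
  · have hi : i ≤ n := by omega
    rcases hj.lt_or_eq with h | h
    · have h1 : j + 1 ≤ n := by omega
      have h2 : i + 1 ≤ n := by omega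
      simp [hochCoface, h1, h2, hi, mergeAt_mergeAt hmu (show i ≤ j by omega)]
    · obtain rfl : j = n := by omega
      rcases hi.lt_or_eq with h2 | rfl
      · have h2' : i + 1 ≤ j := h2
        have hlast : mergeAt mu i a (Fin.last j) = a (Fin.last (j + 1)) := by
          simp [mergeAt, hi.not_gt, h2.ne']
        simp [hochCoface, hi, h2', init_mergeAt, hlast]
      · have hlast : mergeAt mu i a (Fin.last i) =
            mu (Fin.init a (Fin.last i)) (a (Fin.last (i + 1))) := by
          simp [mergeAt, Fin.init]
        simp [hochCoface, init_mergeAt, mergeAt_of_le, hlast, hR]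

theorem alternating_sum_eq_zero {M : Type*} [AddCommGroup M] (N : ℕ) (F : ℕ → ℕ → M)
    (hF : ∀ i j, i ≤ j → j < N → F (j + 1) i = F i j) :
    ∑ j ∈ Finset.range (N + 1), (-1 : ℤ) ^ j •
      ∑ i ∈ Finset.range N, (-1 : ℤ) ^ i • F j i = 0 := by
  simp only [Finset.smul_sum, smul_smul, ← pow_add]
  rw [← Finset.sum_product']
  refine Finset.sum_involution
    (fun x _ => if x.2 < x.1 then (x.2, x.1 - 1) else (x.2 + 1, x.1)) ?_ ?_ ?_ ?_
  · rintro ⟨j, i⟩ h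
    simp only [Finset.mem_product, Finset.mem_range] at h
    dsimp only
    split_ifs with hij
    · obtain ⟨j, rfl⟩ : ∃ l, j = l + 1 := ⟨j - 1, by omega⟩
      rw [hF i j (by omega) (by omega), Nat.add_sub_cancel, ← add_smul,
        show j + 1 + i = i + j + 1 by omega, pow_succ]
      simp
    · rw [hF j i (by omega) (by omega), ← add_smul, show i + 1 + j = j + i + 1 by omega, pow_succ]
      simp
  · rintro ⟨j, i⟩ h _
    dsimp only
    split_ifs <;> simp only [ne_eq, Prod.mk.injEq] <;> omega
  · rintro ⟨j, i⟩ h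
    simp only [Finset.mem_product, Finset.mem_range] at h
    dsimp only
    split_ifs <;> simp only [Finset.mem_product, Finset.mem_range] <;> omega
  · rintro ⟨j, i⟩ h
    dsimp only
    by_cases hij : i < j
    · have h1 : ¬ j - 1 < i := by omega
      have h2 : j - 1 + 1 = j := by omega
      simp [hij, h1, h2]
    · have h1 : j < i + 1 := by omega
      simp [hij, h1]

/-- The Hochschild coboundary with coefficients in a bimodule squares to zero. -/
theorem hochD_hochD {R M : Type*} [AddCommGroup M] {mu : R → R → R}
    {actL actR : R → M →+ M} (hmu : ∀ a b c, mu (mu a b) c = mu a (mu b c))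
    (hL : ∀ a b m, actL (mu a b) m = actL a (actL b m))
    (hR : ∀ a b m, actR (mu a b) m = actR b (actR a m))
    (hLR : ∀ a b m, actR b (actL a m) = actL a (actR b m))
    (n : ℕ) (f : (Fin n → R) → M) :
    hochD mu (fun r m => actL r m) (fun m r => actR r m) (n + 1)
      (hochD mu (fun r m => actL r m) (fun m r => actR r m) n f) = 0 := by
  funext a
  rw [hochD_eq_sum_hochCoface, funext (hochD_eq_sum_hochCoface mu actL actR n f)]
  simp only [hochCoface_sum]
  exact alternating_sum_eq_zero (n + 2) _ fun i j hij hj =>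
    hochCoface_hochCoface hmu hL hR hLR hij (by omega) f a

theorem qtMul_graph {μ : A →ₗ[k] A →ₗ[k] A} {ν : B →ₗ[k] B →ₗ[k] B}
    {tr : A →ₗ[k] B →ₗ[k] B} {tl : B →ₗ[k] A →ₗ[k] B}
    {hr : B →ₗ[k] A →ₗ[k] A} {hl : A →ₗ[k] B →ₗ[k] A} {θ : A →ₗ[k] A →ₗ[k] B} {D : A →ₗ[k] B}
    (hD : ∀ a b : A,
        D (μ a b + hl a (D b) + hr (D a) b) =
          ν (D a) (D b) + tr a (D b) + tl (D a) b + θ a b) (a b : A) :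
    qtMul μ ν tr tl hr hl θ (a, D a) (b, D b) = (muD μ hr hl D a b, D (muD μ hr hl D a b)) := by
  simp only [qtMul, muD, hD]

/-- The left action `▷_D` is left multiplication by the graph of `D`, modulo the graph. -/
theorem trD_sub {μ : A →ₗ[k] A →ₗ[k] A} {ν : B →ₗ[k] B →ₗ[k] B}
    {tr : A →ₗ[k] B →ₗ[k] B} {tl : B →ₗ[k] A →ₗ[k] B}
    {hr : B →ₗ[k] A →ₗ[k] A} {hl : A →ₗ[k] B →ₗ[k] A} {θ : A →ₗ[k] A →ₗ[k] B} {D : A →ₗ[k] B}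
    (hD : ∀ a b : A,
        D (μ a b + hl a (D b) + hr (D a) b) =
          ν (D a) (D b) + tr a (D b) + tl (D a) b + θ a b) (a : A) (q : A × B) :
    trD ν tr hl D a (q.2 - D q.1) =
      (qtMul μ ν tr tl hr hl θ (a, D a) q).2 - D (qtMul μ ν tr tl hr hl θ (a, D a) q).1 := by
  have h := hD a q.1
  rw [← sub_eq_iff_eq_add', map_add, map_add] at h
  simp only [trD, qtMul, map_sub, map_add, ← h]
  abel

/-- The right action `◁_D` is right multiplication by the graph of `D`, modulo the graph. -/
theorem tlD_sub {μ : A →ₗ[k] A →ₗ[k] A} {ν : B →ₗ[k] B →ₗ[k] B}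
    {tr : A →ₗ[k] B →ₗ[k] B} {tl : B →ₗ[k] A →ₗ[k] B}
    {hr : B →ₗ[k] A →ₗ[k] A} {hl : A →ₗ[k] B →ₗ[k] A} {θ : A →ₗ[k] A →ₗ[k] B} {D : A →ₗ[k] B}
    (hD : ∀ a b : A,
        D (μ a b + hl a (D b) + hr (D a) b) =
          ν (D a) (D b) + tr a (D b) + tl (D a) b + θ a b) (q : A × B) (a : A) :
    tlD ν tl hr D (q.2 - D q.1) a =
      (qtMul μ ν tr tl hr hl θ q (a, D a)).2 - D (qtMul μ ν tr tl hr hl θ q (a, D a)).1 := by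
  have h := hD q.1 a
  rw [← sub_eq_iff_eq_add', map_add, map_add] at h
  simp only [tlD, qtMul, map_sub, map_add, LinearMap.sub_apply, ← h]
  abel

/-- for a strong deformation map `D`, the coboundary operator `δ^D`
built from `·_D`, `▷_D`, `◁_D` squares to zero on multilinear cochains. -/
theorem deltaD_squared_zero
    (μ : A →ₗ[k] A →ₗ[k] A) (ν : B →ₗ[k] B →ₗ[k] B)
    (tr : A →ₗ[k] B →ₗ[k] B) (tl : B →ₗ[k] A →ₗ[k] B)
    (hr : B →ₗ[k] A →ₗ[k] A) (hl : A →ₗ[k] B →ₗ[k] A)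
    (θ : A →ₗ[k] A →ₗ[k] B)
    (hA : ∀ p q s : A × B,
        qtMul μ ν tr tl hr hl θ (qtMul μ ν tr tl hr hl θ p q) s =
          qtMul μ ν tr tl hr hl θ p (qtMul μ ν tr tl hr hl θ q s))
    (D : A →ₗ[k] B)
    (hD : ∀ a b : A,
        D (μ a b + hl a (D b) + hr (D a) b) =
          ν (D a) (D b) + tr a (D b) + tl (D a) b + θ a b) :
    ∀ (n : ℕ) (f : MultilinearMap k (fun _ : Fin n => A) B),
      hochD (muD μ hr hl D) (trD ν tr hl D) (tlD ν tl hr D) (n + 1)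
        (hochD (muD μ hr hl D) (trD ν tr hl D) (tlD ν tl hr D) n (fun v => f v)) = 0 := by
  intro n f
  have hL (a : A) (x : B) := trD_sub hD a (0, x)
  have hR (x : B) (a : A) := tlD_sub hD (0, x) a
  simp only [map_zero, sub_zero] at hL hR
  let actL : A → B →+ B := fun a => AddMonoidHom.mk' (trD ν tr hl D a) fun x y => by
    simp only [trD, map_add]; abel
  let actR : A → B →+ B := fun a => AddMonoidHom.mk' (fun x => tlD ν tl hr D x a) fun x y => by
    simp only [tlD, map_add, LinearMap.add_apply]; abel
  refine hochD_hochD (actL := actL) (actR := actR) (fun a b c => ?_) (fun a b x => ?_)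
    (fun a b x => ?_) (fun a b x => ?_) n f
  · have h := congrArg Prod.fst (hA (a, D a) (b, D b) (c, D c))
    simpa only [qtMul_graph hD] using h
  · change trD ν tr hl D _ x = trD ν tr hl D a (trD ν tr hl D b x)
    rw [hL b x, trD_sub hD, ← hA, qtMul_graph hD, hL]
  · change tlD ν tl hr D x _ = tlD ν tl hr D (tlD ν tl hr D x a) b
    rw [hR x a, tlD_sub hD, hA, qtMul_graph hD, hR]
  · change tlD ν tl hr D (trD ν tr hl D a x) b = trD ν tr hl D a (tlD ν tl hr D x b)
    rw [hL a x, tlD_sub hD, hR x b, trD_sub hD, hA]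
end

section
/- Let (𝒜, ≺, ≻, ⋎, ·) be a twisted tridendriform algebra. Then the operation x⋆y := x≺y + x≻y + x⋎y + x·y is associative on 𝒜. -/
/-- A twisted tridendriform algebra structure on `V`: four bilinear operations
`≺ = P`, `≻ = S`, `⋎ = C`, `· = M` satisfying (TT1)–(TT8), where
`x ⋆ y := x≺y + x≻y + x⋎y + x·y`. -/
def IsTwistedTridend {k V : Type*} [Field k] [AddCommGroup V] [Module k V]
    (P S C M : V →ₗ[k] V →ₗ[k] V) : Prop :=
  ∀ x y z : V,
    P (P x y) z = P x (P y z + S y z + C y z + M y z) + M x (C y z) ∧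
    P (S x y) z = S x (P y z) ∧
    S (P x y + S x y + C x y + M x y) z + M (C x y) z = S x (S y z) ∧
    M (S x y) z = S x (M y z) ∧
    M (P x y) z = M x (S y z) ∧
    P (M x y) z = M x (P y z) ∧
    M (M x y) z = M x (M y z) ∧
    P (C x y) z + C (P x y + S x y + C x y + M x y) z
      = S x (C y z) + C x (P y z + S y z + C y z + M y z)

/-- `x ⋆ y := x≺y + x≻y + x⋎y + x·y`. -/
def ttStar {k V : Type*} [Field k] [AddCommGroup V] [Module k V]
    (P S C M : V →ₗ[k] V →ₗ[k] V) (x y : V) : V :=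
  P x y + S x y + C x y + M x y

/-- in a twisted tridendriform algebra, `⋆` is associative. -/
theorem ttStar_assoc {k V : Type*} [Field k] [AddCommGroup V] [Module k V]
    (P S C M : V →ₗ[k] V →ₗ[k] V) (h : IsTwistedTridend P S C M) :
    ∀ x y z : V,
      ttStar P S C M (ttStar P S C M x y) z = ttStar P S C M x (ttStar P S C M y z) := by
  intro x y z
  obtain ⟨h1, h2, h3, h4, h5, h6, h7, h8⟩ := h x y z
  simp only [ttStar, map_add, LinearMap.add_apply] at *
  linear_combination (norm := module) h1 + h2 + h3 + h4 + h5 + h6 + h7 + h8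
end
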